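/- arXiv:1511.03309 — 4 statements merged into one kernel-verified Lean document; each statement's English description precedes it below -/
import Mathlib

section
/- Let F be a field of characteristic ≠ 2, W an F-vector space with a nondegenerate alternating bilinear form ⟨·,·⟩, and W = X ⊕ Y a direct sum decomposition into two Lagrangian subspaces. Let ψ : (F,+) → ℂ^× be a group homomorphism (additive character). For w ∈ W write w = x + y with x ∈ X, y ∈ Y uniquely, and for a function φ : X → ℂ define (ρ(x+y, t)·φ)(x₀) = ψ(t + ⟨x₀,y⟩ + (1/2)⟨x,y⟩)·φ(x₀ + x). Then each ρ(w,t) is a ℂ-linear automorphism of the space of all functions X → ℂ, the map (w,t) ↦ ρ(w,t) is a group homomorphism from the Heisenberg group H(W) to the group of linear automorphisms of that space, and ρ(0,t) is multiplication by the scalar ψ(t) (i.e., the central character is ψ). -/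
/-- The Schrödinger-model action of the Heisenberg group on functions `X → ℂ`:
for `w = x + y` with `x ∈ X`, `y ∈ Y` and `t ∈ F`,
`(ρ(x+y,t)·φ)(x₀) = ψ(t + ⟨x₀,y⟩ + (1/2)⟨x,y⟩)·φ(x₀+x)`. -/
def heisRho {F W : Type*} [Field F] [AddCommGroup W] [Module F W]
    (B : W →ₗ[F] W →ₗ[F] F) (X Y : Submodule F W) (ψ : F → ℂ)
    (x : X) (y : Y) (t : F) (φ : X → ℂ) : X → ℂ :=
  fun x₀ => ψ (t + B (x₀ : W) (y : W) + (1 / 2 : F) * B (x : W) (y : W)) * φ (x₀ + x)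

theorem heisRho_bijective {F W : Type*} [Field F] [AddCommGroup W] [Module F W]
    (B : W →ₗ[F] W →ₗ[F] F) (X Y : Submodule F W) (ψ : F → ℂ) (hψ0 : ∀ a : F, ψ a ≠ 0)
    (x : X) (y : Y) (t : F) : Function.Bijective (heisRho B X Y ψ x y t) := by
  refine ⟨fun φ₁ φ₂ h => ?_, fun φ => ?_⟩
  · funext z
    have hz := congrFun h (z - x)
    simp only [heisRho, sub_add_cancel] at hz
    exact mul_left_cancel₀ (hψ0 _) hz
  · refine ⟨fun z => (ψ (t + B ((z - x : X) : W) (y : W) +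
      (1 / 2 : F) * B (x : W) (y : W)))⁻¹ * φ (z - x), ?_⟩
    funext z
    simp only [heisRho, add_sub_cancel_right]
    exact mul_inv_cancel_left₀ (hψ0 _) _

theorem heisRho_comp {F W : Type*} [Field F] [AddCommGroup W] [Module F W]
    (hchar : (2 : F) ≠ 0) (B : W →ₗ[F] W →ₗ[F] F) (halt : B.IsAlt) (X Y : Submodule F W)
    (hX : ∀ x₁ ∈ X, ∀ x₂ ∈ X, B x₁ x₂ = 0) (hY : ∀ y₁ ∈ Y, ∀ y₂ ∈ Y, B y₁ y₂ = 0)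
    (ψ : F → ℂ) (hψ : ∀ a b : F, ψ (a + b) = ψ a * ψ b)
    (x₁ x₂ : X) (y₁ y₂ : Y) (t₁ t₂ : F) :
    heisRho B X Y ψ x₁ y₁ t₁ ∘ heisRho B X Y ψ x₂ y₂ t₂ =
      heisRho B X Y ψ (x₁ + x₂) (y₁ + y₂)
        (t₁ + t₂ + (1 / 2 : F) * B ((x₁ : W) + (y₁ : W)) ((x₂ : W) + (y₂ : W))) := by
  funext φ x₀
  simp only [Function.comp_apply, heisRho]
  rw [← mul_assoc, ← hψ, add_assoc x₀ x₁ x₂]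
  congr 2
  simp only [Submodule.coe_add, map_add, LinearMap.add_apply, hX x₁ x₁.2 x₂ x₂.2,
    hY y₁ y₁.2 y₂ y₂.2, ← halt.neg (x₂ : W) (y₁ : W)]
  field_simp
  ring

/-- Let `F` be a field of characteristic `≠ 2`, `W` an `F`-vector space with a
nondegenerate alternating bilinear form `B`, `W = X ⊕ Y` a direct sum of two
Lagrangian subspaces, and `ψ : (F,+) → ℂˣ` an additive character.  Then each
`ρ(w,t)` is a `ℂ`-linear automorphism of the space of functions `X → ℂ`, the map
`(w,t) ↦ ρ(w,t)` is a group homomorphism from the Heisenberg group `H(W)`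
(writing `w = x + y` uniquely with `x ∈ X`, `y ∈ Y`), and `ρ(0,t)` is
multiplication by the scalar `ψ(t)`. -/
theorem schrodinger_model
    {F W : Type*} [Field F] [AddCommGroup W] [Module F W]
    (hchar : (2 : F) ≠ 0)
    (B : W →ₗ[F] W →ₗ[F] F)
    (halt : ∀ w : W, B w w = 0)
    (hnd : ∀ w : W, (∀ w' : W, B w w' = 0) → w = 0)
    (X Y : Submodule F W) (hXY : IsCompl X Y)
    (hX : ∀ w : W, w ∈ X ↔ ∀ x ∈ X, B w x = 0)
    (hY : ∀ w : W, w ∈ Y ↔ ∀ y ∈ Y, B w y = 0)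
    (ψ : F → ℂ) (hψ0 : ∀ a : F, ψ a ≠ 0) (hψ : ∀ a b : F, ψ (a + b) = ψ a * ψ b) :
    (∀ (x : X) (y : Y) (t : F),
        Function.Bijective (heisRho B X Y ψ x y t) ∧
        (∀ φ₁ φ₂ : X → ℂ,
          heisRho B X Y ψ x y t (φ₁ + φ₂) =
            heisRho B X Y ψ x y t φ₁ + heisRho B X Y ψ x y t φ₂) ∧
        (∀ (c : ℂ) (φ : X → ℂ),
          heisRho B X Y ψ x y t (c • φ) = c • heisRho B X Y ψ x y t φ)) ∧
    (∀ (x₁ x₂ : X) (y₁ y₂ : Y) (t₁ t₂ : F),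
        heisRho B X Y ψ x₁ y₁ t₁ ∘ heisRho B X Y ψ x₂ y₂ t₂ =
          heisRho B X Y ψ (x₁ + x₂) (y₁ + y₂)
            (t₁ + t₂ + (1 / 2 : F) * B ((x₁ : W) + (y₁ : W)) ((x₂ : W) + (y₂ : W)))) ∧
    (∀ (t : F) (φ : X → ℂ), heisRho B X Y ψ 0 0 t φ = fun x₀ => ψ t * φ x₀) := by
  refine ⟨fun x y t => ⟨heisRho_bijective B X Y ψ hψ0 x y t, fun φ₁ φ₂ => ?_, fun c φ => ?_⟩,
    heisRho_comp hchar B halt X Y (fun x hx => (hX x).1 hx) (fun y hy => (hY y).1 hy) ψ hψ,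
    fun t φ => ?_⟩
  · funext z
    simp [heisRho, mul_add]
  · funext z
    simp [heisRho, mul_left_comm]
  · funext z
    simp [heisRho]
end

section
/- Let F be a field, Δ ∈ F^× with Δ ≠ 0, Q = diag(1,−Δ), and O(Q) = {h ∈ GL(2,F) : h Q hᵀ = Q}. For h = [[t,u],[r,s]] ∈ O(Q) and g = [[a,b],[c,d]] ∈ SL(2,F), define the 4×4 matrix ι(h,g) = [[at, −Δau, bt, bu], [−ar/Δ, as, −br/Δ, −bs/Δ], [ct, −Δcu, dt, du], [cr, −Δcs, dr, ds]]. Then ι is a group homomorphism from O(Q) × SL(2,F) into Sp(4,F) := {M ∈ GL(4,F) : Mᵀ J₄ M = J₄}, where J₄ = [[0,0,1,0],[0,0,0,1],[−1,0,0,0],[0,−1,0,0]], and the kernel of ι is {(I,I), (−I,−I)}. -/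
open Matrix

/-- The embedding `ι` of `O(Q) × SL(2,F)` into `Sp(4,F)`, for
`h = [[t,u],[r,s]]` and `g = [[a,b],[c,d]]`:
`ι(h,g) = [[at, −Δau, bt, bu], [−ar/Δ, as, −br/Δ, −bs/Δ], [ct, −Δcu, dt, du],
[cr, −Δcs, dr, ds]]`. -/
def iotaDP {F : Type*} [Field F] (Δ : F)
    (h g : Matrix (Fin 2) (Fin 2) F) : Matrix (Fin 4) (Fin 4) F :=
  !![g 0 0 * h 0 0, -Δ * (g 0 0 * h 0 1), g 0 1 * h 0 0, g 0 1 * h 0 1;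
     -(g 0 0 * h 1 0) / Δ, g 0 0 * h 1 1, -(g 0 1 * h 1 0) / Δ, -(g 0 1 * h 1 1) / Δ;
     g 1 0 * h 0 0, -Δ * (g 1 0 * h 0 1), g 1 1 * h 0 0, g 1 1 * h 0 1;
     g 1 0 * h 1 0, -Δ * (g 1 0 * h 1 1), g 1 1 * h 1 0, g 1 1 * h 1 1]

/-- An isometry `h` of `diag(1, -Δ)` in the row convention is, after transposing, an isometry of
the inverse form `diag(1, -1/Δ)`. -/
theorem transpose_mul_inv_form_mul {F : Type*} [Field F] {Δ : F} (hΔ : Δ ≠ 0)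
    {h : Matrix (Fin 2) (Fin 2) F} (hh : h * !![1, 0; 0, -Δ] * hᵀ = !![1, 0; 0, -Δ]) :
    hᵀ * !![1, 0; 0, -Δ⁻¹] * h = !![1, 0; 0, -Δ⁻¹] := by
  have hQ : !![1, 0; 0, -Δ] * !![1, 0; 0, -Δ⁻¹] = (1 : Matrix (Fin 2) (Fin 2) F) := by
    simp [hΔ, Matrix.one_fin_two]
  have hQ' := mul_eq_one_comm.mp hQ
  have hright : h * (!![1, 0; 0, -Δ] * hᵀ * !![1, 0; 0, -Δ⁻¹]) = 1 := by
    rw [← mul_assoc, ← mul_assoc, hh, hQ]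
  have hleft := congrArg (!![1, 0; 0, -Δ⁻¹] * ·) (mul_eq_one_comm.mp hright)
  simpa only [← mul_assoc, hQ', one_mul, mul_one] using hleft

theorem iotaDP_mul {F : Type*} [Field F] {Δ : F} (hΔ : Δ ≠ 0)
    (h₁ h₂ g₁ g₂ : Matrix (Fin 2) (Fin 2) F) :
    iotaDP Δ (h₁ * h₂) (g₁ * g₂) = iotaDP Δ h₁ g₁ * iotaDP Δ h₂ g₂ := by
  ext i j
  fin_cases i <;> fin_cases j <;>
    simp [iotaDP, Matrix.mul_apply, Fin.sum_univ_succ] <;> field_simp <;> ring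

theorem iotaDP_symplectic {F : Type*} [Field F] {Δ : F} (hΔ : Δ ≠ 0)
    {h g : Matrix (Fin 2) (Fin 2) F} (hh : h * !![1, 0; 0, -Δ] * hᵀ = !![1, 0; 0, -Δ])
    (hg : g.det = 1) :
    (iotaDP Δ h g)ᵀ * !![0, 0, 1, 0; 0, 0, 0, 1; -1, 0, 0, 0; 0, -1, 0, 0] * iotaDP Δ h g =
      !![0, 0, 1, 0; 0, 0, 0, 1; -1, 0, 0, 0; 0, -1, 0, 0] := by
  have hD := transpose_mul_inv_form_mul hΔ hh
  have h00 := congrFun₂ hD 0 0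
  have h01 := congrFun₂ hD 0 1
  have h11 := congrFun₂ hD 1 1
  simp [Matrix.mul_apply, Fin.sum_univ_succ] at h00 h01 h11
  rw [Matrix.det_fin_two] at hg
  field_simp at h00 h01 h11
  ext i j
  fin_cases i <;> fin_cases j <;>
    simp [iotaDP, Matrix.mul_apply, Fin.sum_univ_succ] <;> field_simp <;> grind

theorem iotaDP_eq_one_iff {F : Type*} [Field F] {Δ : F} (hΔ : Δ ≠ 0)
    {h g : Matrix (Fin 2) (Fin 2) F} (hh : h * !![1, 0; 0, -Δ] * hᵀ = !![1, 0; 0, -Δ]) :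
    iotaDP Δ h g = 1 ↔ (h = 1 ∧ g = 1) ∨ (h = -1 ∧ g = -1) := by
  constructor
  · intro H
    have e00 := congrFun₂ H 0 0
    have e01 := congrFun₂ H 0 1
    have e02 := congrFun₂ H 0 2
    have e11 := congrFun₂ H 1 1
    have e20 := congrFun₂ H 2 0
    have e22 := congrFun₂ H 2 2
    have e10 := congrFun₂ H 1 0
    have hq := congrFun₂ hh 0 0
    simp [iotaDP, hΔ] at e00 e01 e02 e11 e20 e22 e10
    simp [Matrix.mul_apply, Fin.sum_univ_succ] at hq
    have ha : g 0 0 ≠ 0 := left_ne_zero_of_mul_eq_one e00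
    have ht : h 0 0 ≠ 0 := right_ne_zero_of_mul_eq_one e00
    have hu : h 0 1 = 0 := e01.resolve_left ha
    have hr : h 1 0 = 0 := e10.resolve_left ha
    have hb : g 0 1 = 0 := e02.resolve_right ht
    have hc : g 1 0 = 0 := e20.resolve_right ht
    have hs : h 1 1 = h 0 0 := mul_left_cancel₀ ha (e11.trans e00.symm)
    have hd : g 1 1 = g 0 0 := mul_right_cancel₀ ht (e22.trans e00.symm)
    rw [hu] at hq
    have ht2 : h 0 0 = 1 ∨ h 0 0 = -1 := mul_self_eq_one_iff.mp (by simpa using hq)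
    refine ht2.imp (fun ht1 => ?_) (fun ht1 => ?_)
    · have ha1 : g 0 0 = 1 := by simpa [ht1] using e00
      rw [Matrix.eta_fin_two h, Matrix.eta_fin_two g]
      simp [hu, hr, hb, hc, hs, hd, ht1, ha1, Matrix.one_fin_two]
    · have ha1 : g 0 0 = -1 := by
        rw [ht1] at e00
        linear_combination -e00
      rw [Matrix.eta_fin_two h, Matrix.eta_fin_two g]
      simp [hu, hr, hb, hc, hs, hd, ht1, ha1, Matrix.one_fin_two]
  · rintro (⟨rfl, rfl⟩ | ⟨rfl, rfl⟩) <;> ext i j <;> fin_cases i <;> fin_cases j <;>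
      simp [iotaDP]

/-- For `Δ ∈ F^×`, `Q = diag(1,−Δ)`, `O(Q) = {h : hQhᵀ = Q}`, the map `ι` is a group
homomorphism from `O(Q) × SL(2,F)` into
`Sp(4,F) = {M : Mᵀ J₄ M = J₄}` with kernel `{(I,I), (−I,−I)}`. -/
theorem iotaDP_hom_and_kernel {F : Type*} [Field F] (Δ : F) (hΔ : Δ ≠ 0) :
    let Q : Matrix (Fin 2) (Fin 2) F := !![1, 0; 0, -Δ]
    let J₄ : Matrix (Fin 4) (Fin 4) F :=
      !![0, 0, 1, 0; 0, 0, 0, 1; -1, 0, 0, 0; 0, -1, 0, 0]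
    (∀ h g : Matrix (Fin 2) (Fin 2) F, h * Q * hᵀ = Q → g.det = 1 →
        (iotaDP Δ h g)ᵀ * J₄ * iotaDP Δ h g = J₄) ∧
    (∀ h₁ h₂ g₁ g₂ : Matrix (Fin 2) (Fin 2) F,
        h₁ * Q * h₁ᵀ = Q → h₂ * Q * h₂ᵀ = Q → g₁.det = 1 → g₂.det = 1 →
        iotaDP Δ (h₁ * h₂) (g₁ * g₂) = iotaDP Δ h₁ g₁ * iotaDP Δ h₂ g₂) ∧
    (∀ h g : Matrix (Fin 2) (Fin 2) F, h * Q * hᵀ = Q → g.det = 1 →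
        (iotaDP Δ h g = 1 ↔ (h = 1 ∧ g = 1) ∨ (h = -1 ∧ g = -1))) := by
  exact ⟨fun _ _ hh hg => iotaDP_symplectic hΔ hh hg,
    fun h₁ h₂ g₁ g₂ _ _ _ _ => iotaDP_mul hΔ h₁ h₂ g₁ g₂,
    fun _ _ hh _ => iotaDP_eq_one_iff hΔ hh⟩
end

section
/- Let F be an infinite field of characteristic ≠ 2 and Δ ∈ F^× a nonsquare. With Q = diag(1,−Δ), O(Q) = {h ∈ GL(2,F) : h Q hᵀ = Q}, Sp(4,F) = {M ∈ GL(4,F) : Mᵀ J₄ M = J₄} for J₄ = [[0,0,1,0],[0,0,0,1],[−1,0,0,0],[0,−1,0,0]], and ι(h,g) the 4×4 matrix [[at, −Δau, bt, bu], [−ar/Δ, as, −br/Δ, −bs/Δ], [ct, −Δcu, dt, du], [cr, −Δcs, dr, ds]] for h = [[t,u],[r,s]] ∈ O(Q), g = [[a,b],[c,d]] ∈ SL(2,F): the subgroups G = ι(O(Q) × {1}) and G' = ι({1} × SL(2,F)) of Sp(4,F) are mutual centralizers, i.e., the centralizer of G in Sp(4,F) equals G' and the centralizer of G' in Sp(4,F)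 equals G. In other words, (O(Q), SL(2,F)) embedded via ι is a dual reductive pair in Sp(4,F). -/
open Matrix

/-- The two factors of the tensor product commute. -/
theorem iotaDP_one_left_comm {F : Type*} [Field F] {Δ : F} (hΔ0 : Δ ≠ 0)
    (h g : Matrix (Fin 2) (Fin 2) F) :
    iotaDP Δ 1 g * iotaDP Δ h 1 = iotaDP Δ h 1 * iotaDP Δ 1 g := by
  ext i j
  fin_cases i <;> fin_cases j <;>
    simp [iotaDP, Matrix.mul_apply, Fin.sum_univ_four] <;> field_simp

/-- The rational point of the norm-one conic with parameter `1` gives a rotation in `O(Q)`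
with nonzero off-diagonal entries. -/
theorem exists_norm_one_ne_zero {F : Type*} [Field F] (hchar : (2 : F) ≠ 0) {Δ : F}
    (hΔ : ¬ IsSquare Δ) : ∃ t u : F, u ≠ 0 ∧ t ^ 2 - Δ * u ^ 2 = 1 := by
  have h1 : 1 - Δ ≠ 0 := fun h => hΔ ⟨1, by linear_combination -h⟩
  refine ⟨(1 + Δ) / (1 - Δ), 2 / (1 - Δ), div_ne_zero hchar h1, ?_⟩
  field_simp
  ring

/-- A symplectic matrix commuting with `ι(O(Q) × {1})` lies in `ι({1} × SL(2,F))`. -/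
theorem exists_eq_iotaDP_one_left {F : Type*} [Field F] (hchar : (2 : F) ≠ 0) {Δ : F}
    (hΔ0 : Δ ≠ 0) (hΔ : ¬ IsSquare Δ) (M : Matrix (Fin 4) (Fin 4) F)
    (hM : Mᵀ * !![0, 0, 1, 0; 0, 0, 0, 1; -1, 0, 0, 0; 0, -1, 0, 0] * M =
      !![0, 0, 1, 0; 0, 0, 0, 1; -1, 0, 0, 0; 0, -1, 0, 0])
    (hcomm : ∀ h : Matrix (Fin 2) (Fin 2) F, h * !![1, 0; 0, -Δ] * hᵀ = !![1, 0; 0, -Δ] →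
      M * iotaDP Δ h 1 = iotaDP Δ h 1 * M) :
    ∃ g : Matrix (Fin 2) (Fin 2) F, g.det = 1 ∧ M = iotaDP Δ 1 g := by
  obtain ⟨t, u, hu, htu⟩ := exists_norm_one_ne_zero hchar hΔ
  have hrefl := hcomm !![1, 0; 0, -1] (by
    ext i j; fin_cases i <;> fin_cases j <;> simp [Matrix.mul_apply, Fin.sum_univ_two])
  have hrot := hcomm !![t, u; Δ * u, t] (by
    ext i j
    fin_cases i <;> fin_cases j <;> simp [Matrix.mul_apply, Fin.sum_univ_two]
    · linear_combination htu
    · ring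
    · ring
    · linear_combination -Δ * htu)
  have half : ∀ x : F, -x = x → x = 0 := fun x hx =>
    (mul_eq_zero.mp (show 2 * x = 0 by linear_combination -hx)).resolve_left hchar
  have e (i j) := congrFun (congrFun hrefl i) j
  have e01 := e 0 1
  have e03 := e 0 3
  have e10 := e 1 0
  have e12 := e 1 2
  have e21 := e 2 1
  have e23 := e 2 3
  have e30 := e 3 0
  have e32 := e 3 2
  simp [iotaDP, Matrix.mul_apply, Fin.sum_univ_four] at e01 e03 e10 e12 e21 e23 e30 e32
  replace e01 := half _ e01
  replace e03 := half _ e03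
  replace e10 := half _ e10.symm
  replace e12 := half _ e12.symm
  replace e21 := half _ e21
  replace e23 := half _ e23
  replace e30 := half _ e30.symm
  replace e32 := half _ e32.symm
  have f (i j) := congrFun (congrFun hrot i) j
  have f01 := f 0 1
  have f03 := f 0 3
  have f21 := f 2 1
  have f23 := f 2 3
  have s02 := congrFun (congrFun hM 0) 2
  simp [iotaDP, Matrix.mul_apply, Fin.sum_univ_four, e01, e03, e10, e12, e21, e23, e30, e32]
    at f01 f03 f21 f23 s02
  have m11 : M 1 1 = M 0 0 := by grind
  have m13 : M 1 3 = -M 0 2 / Δ := by field_simp; grind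
  have m31 : M 3 1 = -Δ * M 2 0 := by grind
  have m33 : M 3 3 = M 2 2 := by grind
  refine ⟨!![M 0 0, M 0 2; M 2 0, M 2 2], ?_, ?_⟩
  · rw [Matrix.det_fin_two_of]
    linear_combination s02
  · ext i j
    fin_cases i <;> fin_cases j <;>
      simp [iotaDP, e01, e03, e10, e12, e21, e23, e30, e32, m11, m13, m31, m33]

/-- A symplectic matrix commuting with `ι({1} × SL(2,F))` lies in `ι(O(Q) × {1})`. -/
theorem exists_eq_iotaDP_one_right {F : Type*} [Field F] {Δ : F} (hΔ0 : Δ ≠ 0)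
    (M : Matrix (Fin 4) (Fin 4) F)
    (hM : Mᵀ * !![0, 0, 1, 0; 0, 0, 0, 1; -1, 0, 0, 0; 0, -1, 0, 0] * M =
      !![0, 0, 1, 0; 0, 0, 0, 1; -1, 0, 0, 0; 0, -1, 0, 0])
    (hcomm : ∀ g : Matrix (Fin 2) (Fin 2) F, g.det = 1 →
      M * iotaDP Δ 1 g = iotaDP Δ 1 g * M) :
    ∃ h : Matrix (Fin 2) (Fin 2) F, h * !![1, 0; 0, -Δ] * hᵀ = !![1, 0; 0, -Δ] ∧
      M = iotaDP Δ h 1 := by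
  have hupper := hcomm !![1, 1; 0, 1] (by simp)
  have hlower := hcomm !![1, 0; 1, 1] (by simp)
  have e (i j) := congrFun (congrFun hupper i) j
  have f (i j) := congrFun (congrFun hlower i) j
  have e00 := e 0 0
  have e01 := e 0 1
  have e02 := e 0 2
  have e03 := e 0 3
  have e10 := e 1 0
  have e11 := e 1 1
  have e12 := e 1 2
  have e13 := e 1 3
  have f00 := f 0 0
  have f01 := f 0 1
  have f10 := f 1 0
  have f11 := f 1 1
  simp [iotaDP, Matrix.mul_apply, Fin.sum_univ_four, hΔ0]
    at e00 e01 e02 e03 e10 e11 e12 e13 f00 f01 f10 f11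
  have m00 : M 0 0 = M 2 2 := by grind
  have m01 : M 0 1 = -Δ * M 2 3 := by grind
  have m10 : M 1 0 = -M 3 2 / Δ := by grind
  have m11 : M 1 1 = M 3 3 := by grind
  have s (i j) := congrFun (congrFun hM i) j
  have s02 := s 0 2
  have s03 := s 0 3
  have s12 := s 1 2
  have s13 := s 1 3
  simp [Matrix.mul_apply, Fin.sum_univ_four, e00, e01, e10, e11, f00, f01, f10, f11,
    m00, m01, m10, m11] at s02 s03 s12 s13
  refine ⟨!![M 2 2, M 2 3; M 3 2, M 3 3], ?_, ?_⟩
  · have hleft : (!![1, 0; 0, -Δ] * !![M 2 2, M 2 3; M 3 2, M 3 3]ᵀ * !![1, 0; 0, -1 / Δ]) *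
        !![M 2 2, M 2 3; M 3 2, M 3 3] = 1 := by
      ext i j
      fin_cases i <;> fin_cases j <;>
        simp [Matrix.mul_apply, Matrix.vecMul, dotProduct, Fin.sum_univ_two] <;> grind
    have hQ : !![1, 0; 0, -1 / Δ] * !![1, 0; 0, -Δ] = (1 : Matrix (Fin 2) (Fin 2) F) := by
      ext i j
      fin_cases i <;> fin_cases j <;> simp [hΔ0]
    have hright := congrArg (· * !![1, 0; 0, -Δ]) (mul_eq_one_comm.mp hleft)
    simpa only [Matrix.mul_assoc, hQ, Matrix.mul_one, Matrix.one_mul] using hright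
  · ext i j
    fin_cases i <;> fin_cases j <;>
      simp [iotaDP, e00, e01, e10, e11, f00, f01, f10, f11, m00, m01, m10, m11]

/-- Let `F` be an infinite field of characteristic `≠ 2` and `Δ ∈ F^×` a nonsquare.
The images `G = ι(O(Q) × {1})` and `G' = ι({1} × SL(2,F))` in
`Sp(4,F) = {M : Mᵀ J₄ M = J₄}` are mutual centralizers: a symplectic matrix `M`
commutes with all of `G` iff `M ∈ G'`, and commutes with all of `G'` iff `M ∈ G`.
Thus `(O(Q), SL(2,F))` is a dual reductive pair in `Sp(4,F)`. -/
theorem iotaDP_dual_reductive_pair {F : Type*} [Field F] [Infinite F]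
    (hchar : (2 : F) ≠ 0) (Δ : F) (hΔ0 : Δ ≠ 0) (hΔ : ¬ IsSquare Δ) :
    let Q : Matrix (Fin 2) (Fin 2) F := !![1, 0; 0, -Δ]
    let J₄ : Matrix (Fin 4) (Fin 4) F :=
      !![0, 0, 1, 0; 0, 0, 0, 1; -1, 0, 0, 0; 0, -1, 0, 0]
    (∀ M : Matrix (Fin 4) (Fin 4) F, Mᵀ * J₄ * M = J₄ →
        ((∀ h : Matrix (Fin 2) (Fin 2) F, h * Q * hᵀ = Q →
            M * iotaDP Δ h 1 = iotaDP Δ h 1 * M) ↔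
          ∃ g : Matrix (Fin 2) (Fin 2) F, g.det = 1 ∧ M = iotaDP Δ 1 g)) ∧
    (∀ M : Matrix (Fin 4) (Fin 4) F, Mᵀ * J₄ * M = J₄ →
        ((∀ g : Matrix (Fin 2) (Fin 2) F, g.det = 1 →
            M * iotaDP Δ 1 g = iotaDP Δ 1 g * M) ↔
          ∃ h : Matrix (Fin 2) (Fin 2) F, h * Q * hᵀ = Q ∧ M = iotaDP Δ h 1)) := by
  intro Q J₄
  refine ⟨fun M hM => ⟨exists_eq_iotaDP_one_left hchar hΔ0 hΔ M hM, ?_⟩,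
    fun M hM => ⟨exists_eq_iotaDP_one_right hΔ0 M hM, ?_⟩⟩
  · rintro ⟨g, -, rfl⟩ h -
    exact iotaDP_one_left_comm hΔ0 h g
  · rintro ⟨h, -, rfl⟩ g -
    exact (iotaDP_one_left_comm hΔ0 h g).symm
end

section
/- Let F be a field and let P = {[[a,b],[0,d]] ∈ SL(2,F)} be the subgroup of upper-triangular matrices in SL(2,F). Define f : SL(2,F) → F^×/(F^×)² by f([[a,b],[c,d]]) = c·(F^×)² if c ≠ 0 and f([[a,b],[0,d]]) = d·(F^×)². Then for all p₁, p₂ ∈ P and all g ∈ SL(2,F), f(p₁ g p₂) = f(p₁)·f(g)·f(p₂) in F^×/(F^×)². -/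
open Matrix

/-- Rao's function `f : SL(2,F) → F^×/(F^×)²`, given on matrix representatives by
`f([[a,b],[c,d]]) = c` if `c ≠ 0` and `f([[a,b],[0,d]]) = d`. -/
noncomputable def raoF {F : Type*} [Field F] (M : Matrix (Fin 2) (Fin 2) F) : F :=
  open scoped Classical in
  if M 1 0 = 0 then M 1 1 else M 1 0

/-- For `P` the upper-triangular subgroup of `SL(2,F)` and Rao's function
`f : SL(2,F) → F^×/(F^×)²`, one has `f(p₁gp₂) = f(p₁)·f(g)·f(p₂)` in
`F^×/(F^×)²` for all `p₁, p₂ ∈ P` and `g ∈ SL(2,F)`; equality modulo nonzero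
squares is expressed by a factor `e²` with `e ≠ 0`. -/
theorem raoF_biinvariance {F : Type*} [Field F]
    (p₁ p₂ g : Matrix (Fin 2) (Fin 2) F)
    (hp₁det : p₁.det = 1) (hp₁ : p₁ 1 0 = 0)
    (hp₂det : p₂.det = 1) (hp₂ : p₂ 1 0 = 0)
    (hgdet : g.det = 1) :
    ∃ e : F, e ≠ 0 ∧ raoF (p₁ * g * p₂) = raoF p₁ * raoF g * raoF p₂ * e ^ 2 := by
  rw [det_fin_two, hp₁, mul_zero, sub_zero] at hp₁det
  rw [det_fin_two, hp₂, mul_zero, sub_zero] at hp₂det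
  have hd₁ : p₁ 1 1 ≠ 0 := right_ne_zero_of_mul_eq_one hp₁det
  have ha₂ : p₂ 0 0 ≠ 0 := left_ne_zero_of_mul_eq_one hp₂det
  have hlower : (p₁ * g * p₂) 1 0 = p₁ 1 1 * g 1 0 * p₂ 0 0 := by
    simp [mul_apply, Fin.sum_univ_two, hp₁, hp₂]
  by_cases hc : g 1 0 = 0
  · refine ⟨1, one_ne_zero, ?_⟩
    have hcorner : (p₁ * g * p₂) 1 1 = p₁ 1 1 * g 1 1 * p₂ 1 1 := by
      simp [mul_apply, Fin.sum_univ_two, hp₁, hc]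
    simp [raoF, hlower, hcorner, hp₁, hp₂, hc]
  · refine ⟨p₂ 0 0, ha₂, ?_⟩
    have hne : (p₁ * g * p₂) 1 0 ≠ 0 := by
      rw [hlower]
      exact mul_ne_zero (mul_ne_zero hd₁ hc) ha₂
    simp only [raoF, if_neg hne, if_neg hc, if_pos hp₁, if_pos hp₂, hlower]
    linear_combination (-(p₁ 1 1 * g 1 0 * p₂ 0 0)) * hp₂det
end
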